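/- Let z, η ∈ ℂ with Re z > 0 and Re(z + η) > 0. Then e^z · Γ(z + η) = √(2π) · z^{z + η − 1/2} · exp( ∫_0^∞ ( η − 1/2 − 1/s + e^{(1−η)s}/(e^s − 1) ) · e^{−zs} · ds/s ), where Γ is the complex Gamma function, z^{z+η−1/2} is the principal complex power, and the integral converges absolutely (the integrand extends continuously to s = 0 and decays exponentially as s → ∞ since Re z > 0 and Re(z+η) > 0). -/

import Mathlib

open MeasureTheory Real Filter

/-- The integrand of the Binet-type integral for `log Λ(z, η)`. -/
noncomputable def binetIntegrand (z η : ℂ) (s : ℝ) : ℂ :=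
  (η - 1 / 2 - 1 / (s : ℂ) + Complex.exp ((1 - η) * s) / (Complex.exp (s : ℂ) - 1)) *
    Complex.exp (-z * s) / (s : ℂ)

lemma complex_exp_ofReal_sub_one_ne_zero {s : ℝ} (hs : 0 < s) : Complex.exp (s : ℂ) - 1 ≠ 0 := by
  have h : (1 : ℝ) < Real.exp s := Real.one_lt_exp_iff.mpr hs
  rw [sub_ne_zero]
  exact_mod_cast h.ne'

lemma continuousOn_binetIntegrand (z η : ℂ) : ContinuousOn (binetIntegrand z η) (Set.Ioi 0) := by
  have h0 : ∀ s ∈ Set.Ioi (0 : ℝ), (s : ℂ) ≠ 0 := fun s hs => by exact_mod_cast (ne_of_gt hs)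
  have h1 : ∀ s ∈ Set.Ioi (0 : ℝ), Complex.exp (s : ℂ) - 1 ≠ 0 :=
    fun s hs => complex_exp_ofReal_sub_one_ne_zero hs
  unfold binetIntegrand
  fun_prop (disch := assumption)

lemma norm_binet_numerator_le (η : ℂ) {s : ℝ} (hs : 0 < s) (hs1 : s ≤ 1) :
    ‖(η - 1 / 2) * s * (Complex.exp s - 1) - (Complex.exp s - 1) +
      s * Complex.exp ((1 - η) * s)‖ ≤
    (‖η - 1 / 2‖ * Real.exp 1 + Real.exp 1 + ‖1 - η‖ ^ 2 * Real.exp ‖1 - η‖) * s ^ 3 := by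
  have hn : ‖(s : ℂ)‖ = s := by simp [abs_of_pos hs]
  have h2 := Complex.norm_exp_sub_sum_le_norm_mul_exp (s : ℂ) 2
  have h3 := Complex.norm_exp_sub_sum_le_norm_mul_exp (s : ℂ) 3
  have h4 := Complex.norm_exp_sub_sum_le_norm_mul_exp ((1 - η) * s) 2
  rw [norm_mul, hn] at h4
  rw [hn] at h2 h3
  have he : Real.exp s ≤ Real.exp 1 := Real.exp_le_exp.mpr hs1
  have he4 : Real.exp (‖1 - η‖ * s) ≤ Real.exp ‖1 - η‖ :=
    Real.exp_le_exp.mpr (mul_le_of_le_one_right (norm_nonneg _) hs1)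
  set E₂ := Complex.exp (s : ℂ) - ∑ m ∈ Finset.range 2, (s : ℂ) ^ m / m.factorial with hE₂
  set E₃ := Complex.exp (s : ℂ) - ∑ m ∈ Finset.range 3, (s : ℂ) ^ m / m.factorial with hE₃
  set D := Complex.exp ((1 - η) * s) -
    ∑ m ∈ Finset.range 2, ((1 - η) * (s : ℂ)) ^ m / m.factorial with hD
  have key : (η - 1 / 2) * s * (Complex.exp s - 1) - (Complex.exp s - 1) +
      s * Complex.exp ((1 - η) * s) = (η - 1 / 2) * s * E₂ - E₃ + s * D := by
    rw [hE₂, hE₃, hD]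
    simp [Finset.sum_range_succ]
    ring
  rw [key]
  calc _ ≤ ‖(η - 1 / 2) * s * E₂‖ + ‖E₃‖ + ‖s * D‖ :=
        (norm_add_le _ _).trans (add_le_add_left (norm_sub_le _ _) _)
    _ = ‖η - 1 / 2‖ * s * ‖E₂‖ + ‖E₃‖ + s * ‖D‖ := by simp only [norm_mul, hn]
    _ ≤ ‖η - 1 / 2‖ * s * (s ^ 2 * Real.exp 1) + s ^ 3 * Real.exp 1 +
        s * ((‖1 - η‖ * s) ^ 2 * Real.exp ‖1 - η‖) := by
      gcongr
      · exact h2.trans (by gcongr)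
      · exact h3.trans (by gcongr)
      · exact h4.trans (by gcongr)
    _ = _ := by ring

lemma norm_exp_neg_mul_ofReal (z : ℂ) (s : ℝ) :
    ‖Complex.exp (-z * s)‖ = Real.exp (-z.re * s) := by
  simp [Complex.norm_exp]

lemma integrableOn_exp_neg_mul {x : ℝ} (hx : 0 < x) (c : ℝ) :
    IntegrableOn (fun s : ℝ => Real.exp (-x * s)) (Set.Ioi c) :=
  integrableOn_exp_mul_Ioi (neg_lt_zero.mpr hx) c

lemma integrableOn_binetIntegrand_Ioc {z : ℂ} (hz : 0 < z.re) (η : ℂ) :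
    IntegrableOn (binetIntegrand z η) (Set.Ioc 0 1) := by
  refine IntegrableOn.of_bound (by simp)
    (((continuousOn_binetIntegrand z η).mono Set.Ioc_subset_Ioi_self).aestronglyMeasurable
      measurableSet_Ioc)
    (‖η - 1 / 2‖ * Real.exp 1 + Real.exp 1 + ‖1 - η‖ ^ 2 * Real.exp ‖1 - η‖) ?_
  refine (ae_restrict_iff' measurableSet_Ioc).mpr (Eventually.of_forall ?_)
  rintro s ⟨hs, hs1⟩
  have hs0 : (s : ℂ) ≠ 0 := by exact_mod_cast hs.ne'
  have hE := complex_exp_ofReal_sub_one_ne_zero hs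
  have hn : ‖(s : ℂ)‖ = s := by simp [abs_of_pos hs]
  have hEs : s ≤ ‖Complex.exp (s : ℂ) - 1‖ := by
    have h := Real.add_one_le_exp s
    calc s ≤ Real.exp s - 1 := by linarith
      _ ≤ |Real.exp s - 1| := le_abs_self _
      _ = ‖Complex.exp (s : ℂ) - 1‖ := by
        rw [← Real.norm_eq_abs, ← Complex.norm_real]; push_cast; rfl
  have heq : binetIntegrand z η s = ((η - 1 / 2) * s * (Complex.exp s - 1) -
      (Complex.exp s - 1) + s * Complex.exp ((1 - η) * s)) /
        (s * s * (Complex.exp s - 1)) * Complex.exp (-z * s) := by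
    unfold binetIntegrand
    field_simp
  rw [heq, norm_mul, norm_div, norm_exp_neg_mul_ofReal, norm_mul, norm_mul, hn]
  have hexp : Real.exp (-z.re * s) ≤ 1 := Real.exp_le_one_iff.mpr (by nlinarith)
  refine (mul_le_of_le_one_right (by positivity) hexp).trans ?_
  rw [div_le_iff₀ (by positivity)]
  refine (norm_binet_numerator_le η hs hs1).trans ?_
  refine mul_le_mul_of_nonneg_left ?_ (by positivity)
  nlinarith [mul_le_mul_of_nonneg_left hEs (mul_pos hs hs).le]

lemma integrableOn_binetIntegrand_Ioi_one {z η : ℂ} (hz : 0 < z.re) (hzη : 0 < (z + η).re) :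
    IntegrableOn (binetIntegrand z η) (Set.Ioi 1) := by
  have hsub : Set.Ioi (1 : ℝ) ⊆ Set.Ioi 0 := Set.Ioi_subset_Ioi zero_le_one
  refine Integrable.mono' (g := fun s => (‖η - 1 / 2‖ + 1) * Real.exp (-z.re * s) +
      2 * Real.exp (-(z + η).re * s))
    (((integrableOn_exp_neg_mul hz 1).const_mul _).add
      ((integrableOn_exp_neg_mul hzη 1).const_mul _))
    (((continuousOn_binetIntegrand z η).mono hsub).aestronglyMeasurable measurableSet_Ioi) ?_
  refine (ae_restrict_iff' measurableSet_Ioi).mpr (Eventually.of_forall ?_)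
  intro s (hs1 : 1 < s)
  have hs : 0 < s := one_pos.trans hs1
  have hn : ‖(s : ℂ)‖ = s := by simp [abs_of_pos hs]
  have hE := complex_exp_ofReal_sub_one_ne_zero hs
  have hEs : Real.exp s / 2 ≤ ‖Complex.exp (s : ℂ) - 1‖ := by
    have h := Real.add_one_le_exp s
    calc Real.exp s / 2 ≤ Real.exp s - 1 := by linarith
      _ ≤ |Real.exp s - 1| := le_abs_self _
      _ = ‖Complex.exp (s : ℂ) - 1‖ := by
        rw [← Real.norm_eq_abs, ← Complex.norm_real]; push_cast; rfl
  have heq : binetIntegrand z η s = ((η - 1 / 2 - 1 / s) * Complex.exp (-z * s) +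
      Complex.exp (s : ℂ) * Complex.exp (-(z + η) * s) / (Complex.exp s - 1)) / s := by
    rw [← Complex.exp_add, show (s : ℂ) + -(z + η) * s = (1 - η) * s + -z * s by ring,
      Complex.exp_add, binetIntegrand]
    ring
  rw [heq, norm_div, hn]
  refine (div_le_self (norm_nonneg _) hs1.le).trans ((norm_add_le _ _).trans ?_)
  rw [norm_mul, norm_div, norm_mul, norm_exp_neg_mul_ofReal, norm_exp_neg_mul_ofReal]
  have h1 : ‖(1 : ℂ) / s‖ ≤ 1 := by
    rw [norm_div, hn, norm_one]
    exact (div_le_one hs).mpr hs1.le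
  have h2 : ‖Complex.exp (s : ℂ)‖ = Real.exp s := by simp [Complex.norm_exp]
  gcongr
  · exact (norm_sub_le _ _).trans (by gcongr)
  · rw [h2, div_le_iff₀ (by positivity)]
    nlinarith [mul_le_mul_of_nonneg_left hEs (Real.exp_pos (-(z + η).re * s)).le]

lemma integrableOn_binetIntegrand {z η : ℂ} (hz : 0 < z.re) (hzη : 0 < (z + η).re) :
    IntegrableOn (binetIntegrand z η) (Set.Ioi 0) := by
  rw [← Set.Ioc_union_Ioi_eq_Ioi zero_le_one]
  exact (integrableOn_binetIntegrand_Ioc hz η).union (integrableOn_binetIntegrand_Ioi_one hz hzη)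

lemma min_re_le_re_segment (a b : ℂ) {t : ℝ} (ht : t ∈ Set.Icc (0 : ℝ) 1) :
    min a.re b.re ≤ (a + t * (b - a)).re := by
  have h : (a + t * (b - a)).re = (1 - t) * a.re + t * b.re := by simp; ring
  rw [h]
  nlinarith [ht.1, ht.2, min_le_left a.re b.re, min_le_right a.re b.re,
    mul_le_mul_of_nonneg_left (min_le_left a.re b.re) (sub_nonneg.mpr ht.2),
    mul_le_mul_of_nonneg_left (min_le_right a.re b.re) ht.1]

lemma integrable_exp_segment {a b : ℂ} (ha : 0 < a.re) (hb : 0 < b.re) :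
    Integrable (Function.uncurry fun (s t : ℝ) =>
        (b - a) * Complex.exp (-(a + t * (b - a)) * s))
      ((volume.restrict (Set.Ioi (0 : ℝ))).prod (volume.restrict (Set.Ioc (0 : ℝ) 1))) := by
  have hm : 0 < min a.re b.re := lt_min ha hb
  have hdom : Integrable (fun p : ℝ × ℝ => Real.exp (-(min a.re b.re) * p.1) * ‖b - a‖)
      ((volume.restrict (Set.Ioi (0 : ℝ))).prod (volume.restrict (Set.Ioc (0 : ℝ) 1))) :=
    Integrable.mul_prod (f := fun s : ℝ => Real.exp (-(min a.re b.re) * s))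
      (g := fun _ : ℝ => ‖b - a‖) (integrableOn_exp_neg_mul hm 0) (integrable_const _)
  refine hdom.mono' (Continuous.aestronglyMeasurable (by fun_prop)) ?_
  rw [Measure.prod_restrict]
  refine (ae_restrict_iff' (measurableSet_Ioi.prod measurableSet_Ioc)).mpr
    (Eventually.of_forall ?_)
  rintro ⟨s, t⟩ ⟨hs, ht⟩
  have hs : (0 : ℝ) < s := hs
  have h := min_re_le_re_segment a b (Set.Ioc_subset_Icc_self ht)
  simp only [Function.uncurry]
  rw [norm_mul, norm_exp_neg_mul_ofReal, mul_comm]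
  gcongr

lemma integral_exp_segment (a b : ℂ) {s : ℝ} (hs : 0 < s) :
    ∫ t in Set.Ioc (0 : ℝ) 1, (b - a) * Complex.exp (-(a + t * (b - a)) * s) =
      (Complex.exp (-a * s) - Complex.exp (-b * s)) / s := by
  have hs0 : (s : ℂ) ≠ 0 := by exact_mod_cast hs.ne'
  have hd : ∀ t ∈ Set.uIcc (0 : ℝ) 1, HasDerivAt
      (fun t : ℝ => -Complex.exp (-(a + t * (b - a)) * s) / s)
      ((b - a) * Complex.exp (-(a + t * (b - a)) * s)) t := by
    intro t _
    have h1 : HasDerivAt (fun t : ℝ => -(a + t * (b - a)) * (s : ℂ)) (-(1 * (b - a)) * s) t :=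
      (((Complex.ofRealCLM.hasDerivAt (x := t)).mul_const (b - a)).const_add a).neg.mul_const _
    refine (h1.cexp.neg.div_const (s : ℂ)).congr_deriv ?_
    field_simp
  rw [← intervalIntegral.integral_of_le zero_le_one,
    intervalIntegral.integral_eq_sub_of_hasDerivAt hd
      (Continuous.intervalIntegrable (by fun_prop) _ _)]
  simp
  ring

/-- Integrability in **Frullani's integral** for complex exponentials. -/
lemma integrableOn_exp_sub_exp_div {a b : ℂ} (ha : 0 < a.re) (hb : 0 < b.re) :
    IntegrableOn (fun s : ℝ => (Complex.exp (-a * s) - Complex.exp (-b * s)) / s)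
      (Set.Ioi 0) := by
  refine (integrable_exp_segment ha hb).integral_prod_left.congr ?_
  refine (ae_restrict_iff' measurableSet_Ioi).mpr (Eventually.of_forall fun s hs => ?_)
  exact integral_exp_segment a b hs

/-- **Frullani's integral** for complex exponentials. -/
lemma integral_exp_sub_exp_div {a b : ℂ} (ha : 0 < a.re) (hb : 0 < b.re) :
    ∫ s in Set.Ioi (0 : ℝ), (Complex.exp (-a * s) - Complex.exp (-b * s)) / s =
      Complex.log b - Complex.log a := by
  have hre : ∀ t ∈ Set.Icc (0 : ℝ) 1, 0 < (a + t * (b - a)).re := fun t ht =>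
    (lt_min ha hb).trans_le (min_re_le_re_segment a b ht)
  have hne : ∀ t ∈ Set.Icc (0 : ℝ) 1, a + t * (b - a) ≠ 0 := fun t ht h => by
    simpa [h] using hre t ht
  calc ∫ s in Set.Ioi (0 : ℝ), (Complex.exp (-a * s) - Complex.exp (-b * s)) / s
      = ∫ s in Set.Ioi (0 : ℝ), ∫ t in Set.Ioc (0 : ℝ) 1,
          (b - a) * Complex.exp (-(a + t * (b - a)) * s) :=
        setIntegral_congr_fun measurableSet_Ioi fun s hs => (integral_exp_segment a b hs).symm
    _ = ∫ t in Set.Ioc (0 : ℝ) 1, ∫ s in Set.Ioi (0 : ℝ),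
          (b - a) * Complex.exp (-(a + t * (b - a)) * s) :=
        integral_integral_swap (integrable_exp_segment ha hb)
    _ = ∫ t in Set.Ioc (0 : ℝ) 1, (b - a) / (a + t * (b - a)) := by
        refine setIntegral_congr_fun measurableSet_Ioc fun t ht => ?_
        have ht := Set.Ioc_subset_Icc_self ht
        have hneg : (-(a + t * (b - a))).re < 0 := by
          rw [Complex.neg_re]; exact neg_lt_zero.mpr (hre t ht)
        simp only [integral_const_mul, integral_exp_mul_complex_Ioi hneg]
        rw [Complex.ofReal_zero, mul_zero, Complex.exp_zero, neg_div_neg_eq, mul_one_div]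
    _ = _ := by
        have hd : ∀ t ∈ Set.uIcc (0 : ℝ) 1, HasDerivAt
            (fun t : ℝ => Complex.log (a + t * (b - a))) ((b - a) / (a + t * (b - a))) t := by
          intro t ht
          rw [Set.uIcc_of_le zero_le_one] at ht
          have h1 : HasDerivAt (fun t : ℝ => a + t * (b - a)) (1 * (b - a)) t :=
            ((Complex.ofRealCLM.hasDerivAt (x := t)).mul_const (b - a)).const_add a
          simpa using h1.clog_real (Or.inl (hre t ht))
        have hc : ContinuousOn (fun t : ℝ => (b - a) / (a + t * (b - a))) (Set.uIcc 0 1) := by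
          rw [Set.uIcc_of_le zero_le_one]
          fun_prop (disch := assumption)
        rw [← intervalIntegral.integral_of_le zero_le_one,
          intervalIntegral.integral_eq_sub_of_hasDerivAt hd hc.intervalIntegrable]
        simp

lemma tendsto_exp_neg_mul_atTop {a : ℂ} (ha : 0 < a.re) :
    Tendsto (fun s : ℝ => Complex.exp (-a * s)) atTop (nhds 0) := by
  rw [tendsto_zero_iff_norm_tendsto_zero]
  simp only [norm_exp_neg_mul_ofReal]
  exact Real.tendsto_exp_atBot.comp (tendsto_id.const_mul_atTop_of_neg (neg_lt_zero.mpr ha))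

lemma hasDerivAt_exp_neg_mul_ofReal (a : ℂ) (s : ℝ) :
    HasDerivAt (fun s : ℝ => Complex.exp (-a * s)) (-a * Complex.exp (-a * s)) s := by
  refine ((Complex.ofRealCLM.hasDerivAt (x := s)).const_mul (-a)).cexp.congr_deriv ?_
  simp [mul_comm]

/-- The fundamental theorem of calculus on `(0, ∞)` for `(exp (-z s) - exp (-(z + 1) s)) / s`,
which tends to `1` at `0` and to `0` at infinity. -/
lemma integral_deriv_exp_sub_exp_div {z : ℂ} (hz : 0 < z.re)
    (hint : IntegrableOn (fun s : ℝ =>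
      ((-z * Complex.exp (-z * s) - -(z + 1) * Complex.exp (-(z + 1) * s)) * s -
        (Complex.exp (-z * s) - Complex.exp (-(z + 1) * s)) * 1) / (s : ℂ) ^ 2) (Set.Ioi 0)) :
    ∫ s in Set.Ioi (0 : ℝ),
      ((-z * Complex.exp (-z * s) - -(z + 1) * Complex.exp (-(z + 1) * s)) * s -
        (Complex.exp (-z * s) - Complex.exp (-(z + 1) * s)) * 1) / (s : ℂ) ^ 2 = -1 := by
  have hz1 : 0 < (z + 1).re := by simp; linarith
  set num : ℝ → ℂ := fun s => Complex.exp (-z * s) - Complex.exp (-(z + 1) * s) with hnum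
  have hd : ∀ s : ℝ, HasDerivAt num
      (-z * Complex.exp (-z * s) - -(z + 1) * Complex.exp (-(z + 1) * s)) s := fun s =>
    (hasDerivAt_exp_neg_mul_ofReal z s).sub (hasDerivAt_exp_neg_mul_ofReal (z + 1) s)
  set A : ℝ → ℂ := Function.update (fun s => num s / s) 0 1 with hA
  have hA_of_ne : ∀ s ≠ 0, A s = num s / s := fun s hs => by simp [hA, hs]
  have hcont : ContinuousAt A 0 := by
    rw [hA, continuousAt_update_same]
    have h := hasDerivAt_iff_tendsto_slope.mp (hd 0)
    have h1 : -z * Complex.exp (-z * (0 : ℝ)) -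
        -(z + 1) * Complex.exp (-(z + 1) * (0 : ℝ)) = 1 := by
      simp
    rw [h1] at h
    refine h.congr fun s => ?_
    simp [slope, hnum, div_eq_inv_mul]
  have hderiv : ∀ s ∈ Set.Ioi (0 : ℝ), HasDerivAt A
      (((-z * Complex.exp (-z * s) - -(z + 1) * Complex.exp (-(z + 1) * s)) * s -
        (Complex.exp (-z * s) - Complex.exp (-(z + 1) * s)) * 1) / (s : ℂ) ^ 2) s := by
    intro s hs
    have hs0 : s ≠ 0 := ne_of_gt hs
    have hid : HasDerivAt (fun t : ℝ => (t : ℂ)) 1 s := Complex.ofRealCLM.hasDerivAt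
    refine ((hd s).fun_div hid (by exact_mod_cast hs0)).congr_of_eventuallyEq ?_
    filter_upwards [isOpen_ne.mem_nhds hs0] with t ht
    exact hA_of_ne t ht
  have hlim : Tendsto A atTop (nhds 0) := by
    have h : Tendsto (fun s : ℝ => num s * (s : ℂ)⁻¹) atTop (nhds ((0 - 0) * 0)) := by
      refine ((tendsto_exp_neg_mul_atTop hz).sub (tendsto_exp_neg_mul_atTop hz1)).mul ?_
      have := (Complex.continuous_ofReal.tendsto 0).comp tendsto_inv_atTop_zero
      simpa [Function.comp_def] using this
    rw [mul_zero] at h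
    refine h.congr' ?_
    filter_upwards [eventually_ne_atTop 0] with s hs
    rw [hA_of_ne s hs, div_eq_mul_inv]
  rw [integral_Ioi_of_hasDerivAt_of_tendsto hcont.continuousWithinAt hderiv hint hlim]
  simp [hA]

lemma integral_binetIntegrand_sub {z η : ℂ} (hz : 0 < z.re) (hzη : 0 < (z + η).re) :
    (∫ s in Set.Ioi (0 : ℝ), binetIntegrand z η s) -
        ∫ s in Set.Ioi (0 : ℝ), binetIntegrand (z + 1) η s =
      (z + η + 1 / 2) * Complex.log (z + 1) - (z + η - 1 / 2) * Complex.log z - 1 -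
        Complex.log (z + η) := by
  have hz1 : 0 < (z + 1).re := by simp; linarith
  have hzη1 : 0 < (z + 1 + η).re := by simp at hzη ⊢; linarith
  have hF := integrableOn_binetIntegrand hz hzη
  have hF1 := integrableOn_binetIntegrand hz1 hzη1
  have hI := (integrableOn_exp_sub_exp_div hz hz1).const_mul (z + η + 1 / 2)
  have hJ := integrableOn_exp_sub_exp_div hzη hz
  have heq : ∀ s ∈ Set.Ioi (0 : ℝ), binetIntegrand z η s - binetIntegrand (z + 1) η s -
      (z + η + 1 / 2) * ((Complex.exp (-z * s) - Complex.exp (-(z + 1) * s)) / s) -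
      (Complex.exp (-(z + η) * s) - Complex.exp (-z * s)) / s =
      ((-z * Complex.exp (-z * s) - -(z + 1) * Complex.exp (-(z + 1) * s)) * s -
        (Complex.exp (-z * s) - Complex.exp (-(z + 1) * s)) * 1) / (s : ℂ) ^ 2 := by
    intro s hs
    have hs0 : (s : ℂ) ≠ 0 := by exact_mod_cast ne_of_gt hs
    have hE := complex_exp_ofReal_sub_one_ne_zero hs
    have hE0 := Complex.exp_ne_zero (s : ℂ)
    have h1 : Complex.exp (-(z + 1) * s) = Complex.exp (-z * s) / Complex.exp s := by
      rw [← Complex.exp_sub]; ring_nf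
    have h2 : Complex.exp (-(z + η) * s) =
        Complex.exp ((1 - η) * s) * Complex.exp (-z * s) / Complex.exp s := by
      rw [← Complex.exp_add, ← Complex.exp_sub]; ring_nf
    simp only [binetIntegrand]
    rw [h1, h2]
    field_simp
    ring
  have hint := (((hF.sub hF1).sub hI).sub hJ).congr_fun heq measurableSet_Ioi
  have hval := integral_deriv_exp_sub_exp_div hz hint
  rw [← setIntegral_congr_fun measurableSet_Ioi heq,
    integral_sub (by exact (hF.sub hF1).sub hI) hJ, integral_sub (by exact hF.sub hF1) hI,
    integral_sub hF hF1, integral_const_mul, integral_exp_sub_exp_div hz hz1,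
    integral_exp_sub_exp_div hzη hz] at hval
  linear_combination hval

lemma tendsto_integral_binetIntegrand {z η : ℂ} (hz : 0 < z.re) (hzη : 0 < (z + η).re) :
    Tendsto (fun n : ℕ => ∫ s in Set.Ioi (0 : ℝ), binetIntegrand (z + n) η s) atTop
      (nhds 0) := by
  have heq : ∀ (n : ℕ) (s : ℝ), binetIntegrand (z + n) η s =
      binetIntegrand z η s * Complex.exp (-(s : ℂ)) ^ n := by
    intro n s
    rw [binetIntegrand, binetIntegrand, ← Complex.exp_nat_mul,
      show -(z + n) * (s : ℂ) = -z * s + n * -(s : ℂ) by ring, Complex.exp_add]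
    ring
  have hnorm : ∀ s : ℝ, ‖Complex.exp (-(s : ℂ))‖ = Real.exp (-s) := by simp [Complex.norm_exp]
  have hF := integrableOn_binetIntegrand hz hzη
  rw [← integral_zero ℝ ℂ (μ := volume.restrict (Set.Ioi (0 : ℝ)))]
  refine tendsto_integral_of_dominated_convergence (fun s => ‖binetIntegrand z η s‖)
    (fun n => ((continuousOn_binetIntegrand _ η).aestronglyMeasurable measurableSet_Ioi))
    hF.norm (fun n => ?_) ?_
  · refine (ae_restrict_iff' measurableSet_Ioi).mpr (Eventually.of_forall fun s hs => ?_)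
    rw [heq, norm_mul, norm_pow, hnorm]
    refine mul_le_of_le_one_right (norm_nonneg _) (pow_le_one₀ (Real.exp_pos _).le ?_)
    exact Real.exp_le_one_iff.mpr (neg_nonpos.mpr (le_of_lt hs))
  · refine (ae_restrict_iff' measurableSet_Ioi).mpr (Eventually.of_forall fun s hs => ?_)
    simp only [heq]
    have h : Tendsto (fun n : ℕ => Complex.exp (-(s : ℂ)) ^ n) atTop (nhds 0) := by
      refine tendsto_pow_atTop_nhds_zero_of_norm_lt_one ?_
      rw [hnorm]
      exact Real.exp_lt_one_iff.mpr (neg_lt_zero.mpr hs)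
    simpa using h.const_mul (binetIntegrand z η s)

/-- The right-hand side of the Binet-type formula, solved for `Γ (z + η)`. -/
noncomputable def binetGamma (z η : ℂ) : ℂ :=
  (Real.sqrt (2 * π) : ℂ) * z ^ (z + η - 1 / 2) * Complex.exp (-z) *
    Complex.exp (∫ s in Set.Ioi (0 : ℝ), binetIntegrand z η s)

lemma binetGamma_add_one {z η : ℂ} (hz : 0 < z.re) (hzη : 0 < (z + η).re) :
    binetGamma (z + 1) η = (z + η) * binetGamma z η := by
  have hz0 : z ≠ 0 := fun h => by simp [h] at hz
  have hz1 : z + 1 ≠ 0 := fun h => by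
    have := congrArg Complex.re h
    simp at this
    linarith
  have hw : z + η ≠ 0 := fun h => by simp [h] at hzη
  have h := integral_binetIntegrand_sub hz hzη
  unfold binetGamma
  rw [Complex.cpow_def_of_ne_zero hz0, Complex.cpow_def_of_ne_zero hz1]
  have key : Complex.log (z + 1) * (z + 1 + η - 1 / 2) + -(z + 1) +
      (∫ s in Set.Ioi (0 : ℝ), binetIntegrand (z + 1) η s) =
      Complex.log (z + η) + Complex.log z * (z + η - 1 / 2) + -z +
        ∫ s in Set.Ioi (0 : ℝ), binetIntegrand z η s := by
    linear_combination -h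
  have := congrArg Complex.exp key
  simp only [Complex.exp_add, Complex.exp_log hw] at this
  linear_combination (Real.sqrt (2 * π) : ℂ) * this

lemma binetGamma_add_nat {z η : ℂ} (hz : 0 < z.re) (hzη : 0 < (z + η).re) (n : ℕ) :
    binetGamma (z + n) η = (∏ j ∈ Finset.range n, (z + η + j)) * binetGamma z η := by
  induction n with
  | zero => simp
  | succ n ih =>
    have h1 : 0 < (z + n).re := by simp; positivity
    have h2 : 0 < (z + n + η).re := by
      have : (0 : ℝ) ≤ n := n.cast_nonneg
      simp at hzη ⊢
      linarith
    rw [Nat.cast_succ, ← add_assoc, binetGamma_add_one h1 h2, ih, Finset.prod_range_succ]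
    ring

lemma tendsto_log_one_add_div (c w : ℂ) :
    Tendsto (fun n : ℕ => (w + n) * Complex.log (1 + c / n) - c) atTop (nhds 0) := by
  have h0 : Tendsto (fun n : ℕ => c / (n : ℂ)) atTop (nhds 0) :=
    tendsto_const_div_atTop_nhds_zero_nat c
  have h1 : Tendsto (fun n : ℕ => (n : ℂ) * Complex.log (1 + c / n)) atTop (nhds c) := by
    refine Complex.tendsto_nat_mul_log_one_add_of_tendsto (tendsto_const_nhds.congr' ?_)
    filter_upwards [eventually_ne_atTop 0] with n hn
    field_simp
  have h2 : Tendsto (fun n : ℕ => Complex.log (1 + c / n)) atTop (nhds 0) := by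
    have h := (h0.const_add 1).clog (by simp)
    simpa using h
  have h := ((h2.const_mul w).add h1).sub_const c
  simp only [mul_zero, zero_add, sub_self] at h
  exact h.congr fun n => by ring

lemma factorial_eq_stirlingSeq_mul_exp {n : ℕ} (hn : n ≠ 0) :
    (n.factorial : ℂ) = (Stirling.stirlingSeq n : ℂ) * (Real.sqrt 2 : ℂ) *
      Complex.exp ((n + 1 / 2) * Complex.log n - n) := by
  have hn0 : (0 : ℝ) < n := by positivity
  have h : (n.factorial : ℝ) = Stirling.stirlingSeq n * Real.sqrt 2 *
      Real.exp ((n + 1 / 2) * Real.log n - n) := by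
    have hexp : Real.exp ((n + 1 / 2) * Real.log n - n) = Real.sqrt n * (n / Real.exp 1) ^ n := by
      rw [Real.sqrt_eq_rpow, Real.rpow_def_of_pos hn0, div_pow, ← Real.exp_nat_mul, mul_one,
        ← Real.rpow_natCast, Real.rpow_def_of_pos hn0, ← Real.exp_sub, ← Real.exp_add]
      ring_nf
    rw [hexp, Stirling.stirlingSeq, Real.sqrt_mul zero_le_two]
    field_simp
  have := congrArg (fun x : ℝ => (x : ℂ)) h
  push_cast [Complex.ofReal_log hn0.le] at this
  exact this

lemma tendsto_binetGamma_div {z η : ℂ} (hz : 0 < z.re) (hzη : 0 < (z + η).re) :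
    Tendsto (fun n : ℕ => binetGamma (z + (n + 1 : ℕ)) η / ((n : ℂ) ^ (z + η) * n.factorial))
      atTop (nhds 1) := by
  have hF : Tendsto (fun n : ℕ => Complex.exp (∫ s in Set.Ioi (0 : ℝ),
      binetIntegrand (z + (n + 1 : ℕ)) η s)) atTop (nhds 1) := by
    have h := ((tendsto_integral_binetIntegrand hz hzη).comp (tendsto_add_atTop_nat 1)).cexp
    simpa [Function.comp_def] using h
  have hL : Tendsto (fun n : ℕ => Complex.exp
      ((z + η + 1 / 2 + n) * Complex.log (1 + (z + 1) / n) - (z + 1))) atTop (nhds 1) := by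
    simpa using (tendsto_log_one_add_div (z + 1) (z + η + 1 / 2)).cexp
  have hpi : (Real.sqrt π : ℂ) ≠ 0 := by exact_mod_cast (Real.sqrt_pos.mpr Real.pi_pos).ne'
  have hS : Tendsto (fun n : ℕ => (Real.sqrt π : ℂ) / (Stirling.stirlingSeq n : ℂ)) atTop
      (nhds 1) := by
    have h := (Complex.continuous_ofReal.tendsto _).comp Stirling.tendsto_stirlingSeq_sqrt_pi
    have h' := (tendsto_const_nhds (x := (Real.sqrt π : ℂ))).div h hpi
    rw [div_self hpi] at h'
    exact h'
  have hprod := (hS.mul hL).mul hF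
  simp only [mul_one] at hprod
  refine hprod.congr' ?_
  filter_upwards [eventually_ne_atTop 0] with n hn
  have hn0 : (0 : ℝ) < n := by positivity
  have hnC : (n : ℂ) ≠ 0 := by exact_mod_cast hn
  have hre : 0 < (z + (n + 1 : ℕ)).re := by
    simp; positivity
  have hzn : z + (n + 1 : ℕ) ≠ 0 := fun h => by simp only [h, Complex.zero_re, lt_irrefl] at hre
  have hfac : z + (n + 1 : ℕ) = (n : ℝ) * (1 + (z + 1) / n) := by
    push_cast
    field_simp
    ring
  have h1 : 1 + (z + 1) / (n : ℂ) ≠ 0 := fun h => hzn (by rw [hfac, h, mul_zero])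
  have hlog : Complex.log (z + (n + 1 : ℕ)) = Complex.log n + Complex.log (1 + (z + 1) / n) := by
    rw [hfac, Complex.log_ofReal_mul hn0 h1, Complex.ofReal_log hn0.le, Complex.ofReal_natCast]
  have hst : (Stirling.stirlingSeq n : ℂ) ≠ 0 := by
    obtain ⟨m, rfl⟩ := Nat.exists_eq_succ_of_ne_zero hn
    exact_mod_cast (Stirling.stirlingSeq'_pos m).ne'
  have h2 : (Real.sqrt 2 : ℂ) ≠ 0 := by exact_mod_cast (Real.sqrt_pos.mpr two_pos).ne'
  unfold binetGamma
  rw [factorial_eq_stirlingSeq_mul_exp hn, Complex.cpow_def_of_ne_zero hnC,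
    Complex.cpow_def_of_ne_zero hzn, hlog, Real.sqrt_mul zero_le_two, Complex.ofReal_mul]
  have key : Complex.exp ((Complex.log n + Complex.log (1 + (z + 1) / n)) *
      (z + (n + 1 : ℕ) + η - 1 / 2)) * Complex.exp (-(z + (n + 1 : ℕ))) =
      Complex.exp ((z + η + 1 / 2 + n) * Complex.log (1 + (z + 1) / n) - (z + 1)) *
      (Complex.exp (Complex.log n * (z + η)) *
        Complex.exp ((n + 1 / 2) * Complex.log n - n)) := by
    simp only [← Complex.exp_add]
    push_cast
    ring_nf
  have e1 := Complex.exp_ne_zero (Complex.log n * (z + η))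
  have e2 := Complex.exp_ne_zero ((n + 1 / 2) * Complex.log n - n)
  rw [mul_assoc _ (Complex.exp ((Complex.log n + _) * _)), key]
  generalize Complex.exp ((n + 1 / 2) * Complex.log n - n) = X at *
  generalize Complex.exp (Complex.log n * (z + η)) = Y at *
  field_simp

lemma binetGamma_eq_Gamma {z η : ℂ} (hz : 0 < z.re) (hzη : 0 < (z + η).re) :
    binetGamma z η = Complex.Gamma (z + η) := by
  have h := (Complex.GammaSeq_tendsto_Gamma (z + η)).mul (tendsto_binetGamma_div hz hzη)
  rw [mul_one] at h
  refine tendsto_nhds_unique (tendsto_const_nhds.congr' ?_) h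
  filter_upwards [eventually_ne_atTop 0] with n hn
  have hnC : (n : ℂ) ^ (z + η) ≠ 0 := by
    rw [Complex.cpow_def_of_ne_zero (by exact_mod_cast hn)]
    exact Complex.exp_ne_zero _
  have hfac : (n.factorial : ℂ) ≠ 0 := by exact_mod_cast n.factorial_ne_zero
  have hprod : ∏ j ∈ Finset.range (n + 1), (z + η + j) ≠ 0 := by
    refine Finset.prod_ne_zero_iff.mpr fun j _ hj => ?_
    have := congrArg Complex.re hj
    have hj0 : (0 : ℝ) ≤ j := j.cast_nonneg
    simp at this hzη
    linarith
  rw [binetGamma_add_nat hz hzη, Complex.GammaSeq]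
  field_simp

theorem stmt19 (z η : ℂ) (hz : 0 < z.re) (hzη : 0 < (z + η).re) :
    IntegrableOn (fun s : ℝ =>
        (η - 1 / 2 - 1 / (s : ℂ) +
            Complex.exp ((1 - η) * s) / (Complex.exp (s : ℂ) - 1)) *
          Complex.exp (-z * s) / (s : ℂ)) (Set.Ioi 0) ∧
    Complex.exp z * Complex.Gamma (z + η) =
      (Real.sqrt (2 * π) : ℂ) * z ^ (z + η - 1 / 2) *
        Complex.exp (∫ s in Set.Ioi (0 : ℝ),
          (η - 1 / 2 - 1 / (s : ℂ) +
              Complex.exp ((1 - η) * s) / (Complex.exp (s : ℂ) - 1)) *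
            Complex.exp (-z * s) / (s : ℂ)) := by
  refine ⟨integrableOn_binetIntegrand hz hzη, ?_⟩
  change _ = _ * _ * Complex.exp (∫ s in Set.Ioi (0 : ℝ), binetIntegrand z η s)
  rw [← binetGamma_eq_Gamma hz hzη, binetGamma, Complex.exp_neg]
  have := Complex.exp_ne_zero z
  field_simp
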